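/- Let k ≥ 3 and n ≥ 4k be integers, let G* be a graph attaining the maximum spectral radius among all minimally (k,k)-edge-connected graphs of order n, and let x be the Perron eigenvector of the adjacency matrix of G* with u* a vertex of maximal entry x_{u*} = max{x_v : v ∈ V(G*)}. Then u* is the unique cut vertex of G*. -/

import Mathlib

open SimpleGraph

/-- The `l`-edge-connectivity of a graph: the minimum number of edges whose removal
leaves a graph with at least `l` connected components, if the graph has at least `l`
vertices; otherwise the number of vertices. -/
noncomputable def edgeConnL {V : Type*} (l : ℕ) (G : SimpleGraph V) : ℕ :=
  if l ≤ Nat.card V then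
    sInf {c : ℕ | ∃ F : Set (Sym2 V), F ⊆ G.edgeSet ∧ F.ncard = c ∧
      l ≤ Nat.card (G.deleteEdges F).ConnectedComponent}
  else Nat.card V

/-- A graph is minimally `(k,l)`-edge-connected if it is connected, its
`l`-edge-connectivity is at least `k`, and deleting any edge drops the
`l`-edge-connectivity below `k`. -/
def IsMinimallyKLEdgeConnected {V : Type*} (k l : ℕ) (G : SimpleGraph V) : Prop :=
  G.Connected ∧ k ≤ edgeConnL l G ∧
    ∀ e ∈ G.edgeSet, edgeConnL l (G.deleteEdges {e}) < k

/-- The real adjacency matrix of a simple graph. -/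
noncomputable def adjMat {V : Type*} (G : SimpleGraph V) : Matrix V V ℝ :=
  letI := Classical.decRel G.Adj
  G.adjMatrix ℝ

/-- The spectral radius of a graph: the largest (real) eigenvalue of its adjacency matrix. -/
noncomputable def specRad {V : Type*} [Fintype V] [DecidableEq V]
    (G : SimpleGraph V) : ℝ :=
  sSup (spectrum ℝ (adjMat G))

/-- `v` is a cut vertex of the (connected) graph `G`: deleting `v` disconnects `G`. -/
def IsCutVtx {V : Type*} (G : SimpleGraph V) (v : V) : Prop :=
  ¬ (G.induce {w | w ≠ v}).Connected

open Matrix in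
lemma posSemidef_specRad_sub_adjMat {V : Type*} [Fintype V] [DecidableEq V]
    (G : SimpleGraph V) : (algebraMap ℝ (Matrix V V ℝ) (specRad G) - adjMat G).PosSemidef := by
  classical
  have hA : (adjMat G).IsHermitian := by
    unfold adjMat
    exact SimpleGraph.isSymm_adjMatrix (α := ℝ) G
  rw [posSemidef_iff_isHermitian_and_spectrum_nonneg]
  refine ⟨?_, ?_⟩
  · refine IsHermitian.sub ?_ hA
    rw [algebraMap_eq_diagonal]
    exact isHermitian_diagonal _
  · rw [← spectrum.singleton_sub_eq]
    rintro r ⟨a, rfl, b, hb, rfl⟩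
    have : b ≤ specRad G := le_csSup (finite_real_spectrum (A := adjMat G)).bddAbove hb
    simpa using this

lemma dotProduct_adjMat_mulVec_le {V : Type*} [Fintype V] [DecidableEq V]
    (G : SimpleGraph V) (y : V → ℝ) :
    y ⬝ᵥ (adjMat G).mulVec y ≤ specRad G * (y ⬝ᵥ y) := by
  have h := (posSemidef_specRad_sub_adjMat G).dotProduct_mulVec_nonneg y
  rw [Matrix.sub_mulVec, Algebra.algebraMap_eq_smul_one, Matrix.smul_mulVec,
    Matrix.one_mulVec, dotProduct_sub, dotProduct_smul] at h
  simpa using h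

lemma adjMat_mulVec_eq_of_le {V : Type*} [Fintype V] [DecidableEq V]
    (G : SimpleGraph V) (y : V → ℝ)
    (hy : specRad G * (y ⬝ᵥ y) ≤ y ⬝ᵥ (adjMat G).mulVec y) :
    (adjMat G).mulVec y = specRad G • y := by
  have h0 : star y ⬝ᵥ (algebraMap ℝ (Matrix V V ℝ) (specRad G) - adjMat G).mulVec y = 0 := by
    rw [Matrix.sub_mulVec, Algebra.algebraMap_eq_smul_one, Matrix.smul_mulVec,
      Matrix.one_mulVec, dotProduct_sub, dotProduct_smul]
    have := dotProduct_adjMat_mulVec_le G y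
    simp only [star_trivial, smul_eq_mul]
    linarith
  have h1 := ((posSemidef_specRad_sub_adjMat G).dotProduct_mulVec_zero_iff y).1 h0
  rw [Matrix.sub_mulVec, Algebra.algebraMap_eq_smul_one, Matrix.smul_mulVec,
      Matrix.one_mulVec, sub_eq_zero] at h1
  exact h1.symm

open Classical in
lemma adjMat_mulVec_apply {V : Type*} [Fintype V] (G : SimpleGraph V) (y : V → ℝ) (v : V) :
    (adjMat G).mulVec y v = ∑ w, if G.Adj v w then y w else 0 := by
  simp [adjMat, Matrix.mulVec, dotProduct, SimpleGraph.adjMatrix_apply]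

/-- The spanning subgraph of `G` formed by the edges joining distinct colours of `c`. -/
def cutGraph {V C : Type*} (G : SimpleGraph V) (c : V → C) : SimpleGraph V where
  Adj a b := G.Adj a b ∧ c a ≠ c b
  symm := ⟨fun _ _ h => ⟨h.1.symm, h.2.symm⟩⟩
  loopless := ⟨fun _ h => h.2 rfl⟩

/-- The number of edges of `G` joining distinct colours of `c`. -/
noncomputable def cutSize {V C : Type*} (G : SimpleGraph V) (c : V → C) : ℕ :=
  (cutGraph G c).edgeSet.ncard

lemma edgeConnL_le_cutSize {V C : Type*} [Finite V] [Finite C] {k : ℕ} (G : SimpleGraph V)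
    (hk : k ≤ Nat.card V) (hC : Nat.card C = k) (c : V → C) (hc : c.Surjective) :
    edgeConnL k G ≤ cutSize G c := by
  rw [edgeConnL, if_pos hk]
  refine Nat.sInf_le ⟨(cutGraph G c).edgeSet, ?_, rfl, ?_⟩
  · exact SimpleGraph.edgeSet_mono fun a b h => h.1
  · rw [← hC]
    let f : (G.deleteEdges (cutGraph G c).edgeSet).ConnectedComponent → C :=
      SimpleGraph.ConnectedComponent.lift c (by
        rintro a b p -
        induction p with
        | nil => rfl
        | cons h _ ih =>
          rw [← ih]
          rw [SimpleGraph.deleteEdges_adj] at h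
          by_contra hne
          exact h.2 ⟨h.1, hne⟩)
    refine Nat.card_le_card_of_surjective f fun i => ?_
    obtain ⟨v, rfl⟩ := hc i
    exact ⟨SimpleGraph.connectedComponentMk _ v, rfl⟩

lemma exists_cutSize_le_edgeConnL {V : Type*} [Finite V] {k : ℕ} (G : SimpleGraph V)
    (hk0 : 0 < k) (hk : k ≤ Nat.card V) :
    ∃ c : V → Fin k, c.Surjective ∧ cutSize G c ≤ edgeConnL k G := by
  rw [edgeConnL, if_pos hk]
  have hne : {t : ℕ | ∃ F : Set (Sym2 V), F ⊆ G.edgeSet ∧ F.ncard = t ∧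
      k ≤ Nat.card (G.deleteEdges F).ConnectedComponent}.Nonempty := by
    refine ⟨_, G.edgeSet, subset_rfl, rfl, hk.trans ?_⟩
    refine Nat.card_le_card_of_injective
      (SimpleGraph.connectedComponentMk (G.deleteEdges G.edgeSet)) fun a b hab => ?_
    rw [SimpleGraph.ConnectedComponent.eq] at hab
    obtain ⟨p⟩ := hab
    cases p with
    | nil => rfl
    | cons h _ => simp at h
  obtain ⟨F, hF, hFc, hFk⟩ := Nat.sInf_mem hne
  rw [← hFc]
  set K := (G.deleteEdges F).ConnectedComponent
  have : Nonempty (Fin k) := ⟨⟨0, hk0⟩⟩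
  obtain ⟨e⟩ : Nonempty (Fin k ↪ K) := by
    have := Fintype.ofFinite K
    refine Function.Embedding.nonempty_of_card_le ?_
    simpa [Nat.card_eq_fintype_card] using hFk
  refine ⟨fun v => Function.invFun e (SimpleGraph.connectedComponentMk _ v), ?_, ?_⟩
  · intro i
    obtain ⟨v, hv⟩ := (e i).exists_rep
    refine ⟨v, ?_⟩
    have : SimpleGraph.connectedComponentMk (G.deleteEdges F) v = e i := hv
    simp only [this]
    exact Function.leftInverse_invFun e.injective i
  · refine Set.ncard_le_ncard ?_ (Set.toFinite _)
    intro s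
    induction s with
    | h a b =>
      rintro ⟨hab, hne⟩
      by_contra hs
      refine hne ?_
      have : (G.deleteEdges F).Adj a b := by
        rw [SimpleGraph.deleteEdges_adj]; exact ⟨hab, hs⟩
      simp only [SimpleGraph.ConnectedComponent.sound this.reachable]

/-- The edge set of `G` is covered by `k`-colourings with exactly `k` bichromatic edges, and
no `k`-colouring has fewer. -/
structure IsPartitionMinimal {V : Type*} (k : ℕ) (G : SimpleGraph V) : Prop where
  connected : G.Connected
  le_cutSize : ∀ c : V → Fin k, c.Surjective → k ≤ cutSize G c
  exists_cutSize_le : ∀ a b, G.Adj a b →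
    ∃ c : V → Fin k, c.Surjective ∧ c a ≠ c b ∧ cutSize G c ≤ k

lemma cutSize_deleteEdges_of_ne {V C : Type*} [Finite V] (G : SimpleGraph V) (c : V → C)
    {a b : V} (hab : G.Adj a b) (hc : c a ≠ c b) :
    cutSize (G.deleteEdges {s(a, b)}) c + 1 = cutSize G c := by
  have h : (cutGraph (G.deleteEdges {s(a, b)}) c).edgeSet
      = (cutGraph G c).edgeSet \ {s(a, b)} := by
    ext s
    induction s with
    | h p q => simp [cutGraph]; tauto
  rw [cutSize, cutSize, h]
  exact Set.ncard_sdiff_singleton_add_one (show (cutGraph G c).Adj a b from ⟨hab, hc⟩)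
    (Set.toFinite _)

lemma cutSize_deleteEdges_of_eq {V C : Type*} (G : SimpleGraph V) (c : V → C)
    {a b : V} (hc : c a = c b) :
    cutSize (G.deleteEdges {s(a, b)}) c = cutSize G c := by
  have h : cutGraph (G.deleteEdges {s(a, b)}) c = cutGraph G c := by
    ext p q
    simp only [cutGraph, SimpleGraph.deleteEdges_adj, Set.mem_singleton_iff, Sym2.eq_iff]
    constructor
    · tauto
    · rintro ⟨h1, h2⟩
      refine ⟨⟨h1, ?_⟩, h2⟩
      rintro (⟨rfl, rfl⟩ | ⟨rfl, rfl⟩)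
      · exact h2 hc
      · exact h2 hc.symm
  rw [cutSize, cutSize, h]

lemma isMinimallyKLEdgeConnected_iff_isPartitionMinimal {V : Type*} [Finite V] {k : ℕ}
    (G : SimpleGraph V) (hk0 : 0 < k) (hk : k ≤ Nat.card V) :
    IsMinimallyKLEdgeConnected k k G ↔ IsPartitionMinimal k G := by
  have hF : Nat.card (Fin k) = k := by simp
  constructor
  · rintro ⟨h1, h2, h3⟩
    have h2' : ∀ c : V → Fin k, c.Surjective → k ≤ cutSize G c := fun c hc =>
      h2.trans (edgeConnL_le_cutSize G hk hF c hc)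
    refine ⟨h1, h2', fun a b hab => ?_⟩
    obtain ⟨c, hc, hle⟩ := exists_cutSize_le_edgeConnL (G.deleteEdges {s(a, b)}) hk0 hk
    have h4 := h3 s(a, b) hab
    have h5 := h2' c hc
    have hne : c a ≠ c b := fun h => by
      rw [cutSize_deleteEdges_of_eq G c h] at hle
      omega
    have := cutSize_deleteEdges_of_ne G c hab hne
    exact ⟨c, hc, hne, by omega⟩
  · rintro ⟨h1, h2, h3⟩
    refine ⟨h1, ?_, ?_⟩
    · obtain ⟨c, hc, hle⟩ := exists_cutSize_le_edgeConnL G hk0 hk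
      exact (h2 c hc).trans hle
    · intro e
      induction e with
      | h a b =>
        intro hab
        obtain ⟨c, hc, hne, hle⟩ := h3 a b hab
        have h4 : cutSize (G.deleteEdges {s(a, b)}) c + 1 = cutSize G c :=
          cutSize_deleteEdges_of_ne G c hab hne
        have h5 := edgeConnL_le_cutSize (G.deleteEdges {s(a, b)}) hk hF c hc
        change edgeConnL k (G.deleteEdges {s(a, b)}) < k
        omega

lemma two_mul_cutSize {V C : Type*} [Finite V] (G : SimpleGraph V) (c : V → C) :
    2 * cutSize G c = {p : V × V | G.Adj p.1 p.2 ∧ c p.1 ≠ c p.2}.ncard := by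
  classical
  have := Fintype.ofFinite V
  rw [cutSize, ← SimpleGraph.coe_edgeFinset, Set.ncard_coe_finset,
    ← SimpleGraph.dart_card_eq_twice_card_edges, ← Nat.card_eq_fintype_card,
    ← Nat.card_coe_set_eq]
  exact Nat.card_congr
    { toFun := fun d => ⟨d.toProd, d.adj⟩
      invFun := fun p => ⟨p.1, p.2⟩
      left_inv := fun _ => rfl
      right_inv := fun _ => rfl }

lemma mem_of_reachable_of_closed {V : Type*} {G : SimpleGraph V} {A : Set V}
    (hA : ∀ a b, G.Adj a b → a ∈ A → b ∈ A) {a b : V} (h : G.Reachable a b) (ha : a ∈ A) :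
    b ∈ A := by
  obtain ⟨p⟩ := h
  induction p with
  | nil => exact ha
  | cons h _ ih => exact ih (hA _ _ h ha)

lemma exists_adj_of_connected {V : Type*} {G : SimpleGraph V} (hG : G.Connected) {A : Set V}
    {a b : V} (ha : a ∈ A) (hb : b ∉ A) : ∃ p q, G.Adj p q ∧ p ∈ A ∧ q ∉ A := by
  by_contra! h
  exact hb (mem_of_reachable_of_closed h (hG.preconnected a b) ha)

lemma IsCutVtx.exists_set {V : Type*} {G : SimpleGraph V} {u v : V} (hv : IsCutVtx G v)
    (huv : u ≠ v) : ∃ A : Set V, A.Nonempty ∧ u ∉ A ∧ v ∉ A ∧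
      ∀ a b, G.Adj a b → a ∈ A → b ∉ A → b = v := by
  set H := G.induce {w | w ≠ v}
  have hne : Nonempty {w : V | w ≠ v} := ⟨⟨u, huv⟩⟩
  have h1 : ∃ w, ¬ H.Reachable ⟨u, huv⟩ w := by
    by_contra! h
    exact hv ⟨fun a b => (h a).symm.trans (h b)⟩
  obtain ⟨⟨w, hw⟩, hwr⟩ := h1
  refine ⟨{a | ∃ h : a ≠ v, ¬ H.Reachable ⟨u, huv⟩ ⟨a, h⟩}, ⟨w, hw, hwr⟩, ?_, ?_, ?_⟩
  · rintro ⟨h, h'⟩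
    exact h' (SimpleGraph.Reachable.refl _)
  · rintro ⟨h, -⟩
    exact h rfl
  · rintro a b hab ⟨ha, har⟩ hb
    by_contra hbv
    refine hb ⟨hbv, fun hr => har (hr.trans ?_)⟩
    exact SimpleGraph.Adj.reachable (show G.Adj b a from hab.symm)

lemma isCutVtx_of_set {V : Type*} {G : SimpleGraph V} {A : Set V} {v a b : V}
    (ha : a ∈ A) (hav : a ≠ v) (hb : b ∉ A) (hbv : b ≠ v)
    (hA : ∀ p q, G.Adj p q → p ∈ A → q ∉ A → p = v ∨ q = v) : IsCutVtx G v := by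
  intro hconn
  refine hb (mem_of_reachable_of_closed (A := {w : {w : V | w ≠ v} | w.1 ∈ A}) ?_
    (hconn.preconnected ⟨a, hav⟩ ⟨b, hbv⟩) ha)
  rintro ⟨p, hp⟩ ⟨q, hq⟩ hpq hpA
  by_contra hqA
  rcases hA p q hpq hpA hqA with h | h
  · exact hp h
  · exact hq h

/-- `G'` is obtained from `G` by detaching the vertex set `A` from `v` and attaching it
to `u` in the same way, where `v` (resp. `u`) is the only vertex outside `A` with neighbours in
`A` in `G` (resp. `G'`). -/
structure IsReattachment {V : Type*} (A : Set V) (G : SimpleGraph V) (v : V)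
    (G' : SimpleGraph V) (u : V) : Prop where
  source_notMem : v ∉ A
  target_notMem : u ∉ A
  adj_iff : ∀ a b, (a ∈ A ↔ b ∈ A) → (G.Adj a b ↔ G'.Adj a b)
  eq_source : ∀ a b, G.Adj a b → a ∈ A → b ∉ A → b = v
  eq_target : ∀ a b, G'.Adj a b → a ∈ A → b ∉ A → b = u
  adj_source_iff : ∀ a ∈ A, (G.Adj a v ↔ G'.Adj a u)

namespace IsReattachment

variable {V C : Type*} {A : Set V} {G G' : SimpleGraph V} {u v : V}

lemma symm (h : IsReattachment A G v G' u) : IsReattachment A G' u G v where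
  source_notMem := h.target_notMem
  target_notMem := h.source_notMem
  adj_iff a b hab := (h.adj_iff a b hab).symm
  eq_source := h.eq_target
  eq_target := h.eq_source
  adj_source_iff a ha := (h.adj_source_iff a ha).symm

open Classical in
/-- The colouring of the reattached graph with the same bichromatic edges. -/
noncomputable def recolor (A : Set V) (v u : V) (c : V → C) : V → C := fun a =>
  if a ∈ A then Equiv.swap (c v) (c u) (c a) else c a

lemma recolor_of_mem {a : V} (ha : a ∈ A) (c : V → C) :
    recolor A v u c a = (open Classical in Equiv.swap (c v) (c u) (c a)) := if_pos ha

lemma recolor_of_notMem {a : V} (ha : a ∉ A) (c : V → C) : recolor A v u c a = c a := if_neg ha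

lemma recolor_of_eq {c : V → C} (hc : c v = c u) : recolor A v u c = c := by
  classical
  funext a
  by_cases ha : a ∈ A
  · rw [recolor_of_mem ha, hc, Equiv.swap_self, Equiv.refl_apply]
  · exact recolor_of_notMem ha c

lemma recolor_surjective (hv : v ∉ A) (hu : u ∉ A) {c : V → C} (hc : c.Surjective) :
    (recolor A v u c).Surjective := by
  classical
  intro i
  by_cases h1 : i = c v
  · exact ⟨v, by rw [recolor_of_notMem hv, h1]⟩
  by_cases h2 : i = c u
  · exact ⟨u, by rw [recolor_of_notMem hu, h2]⟩
  obtain ⟨a, rfl⟩ := hc i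
  refine ⟨a, ?_⟩
  by_cases ha : a ∈ A
  · rw [recolor_of_mem ha]
    exact Equiv.swap_apply_of_ne_of_ne h1 h2
  · exact recolor_of_notMem ha c

lemma recolor_ne_iff (c : V → C) {a b : V}
    (hab : a ∈ A ↔ b ∈ A) : recolor A v u c a ≠ recolor A v u c b ↔ c a ≠ c b := by
  classical
  by_cases ha : a ∈ A
  · rw [recolor_of_mem ha, recolor_of_mem (hab.1 ha), (Equiv.injective _).ne_iff]
  · rw [recolor_of_notMem ha, recolor_of_notMem (fun hb => ha (hab.2 hb))]

lemma recolor_ne_target_iff (h : IsReattachment A G v G' u) (c : V → C) {a : V}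
    (ha : a ∈ A) : recolor A v u c a ≠ recolor A v u c u ↔ c a ≠ c v := by
  classical
  rw [recolor_of_mem ha, recolor_of_notMem h.target_notMem]
  rw [← (Equiv.swap (c v) (c u)).injective.ne_iff (x := c a), Equiv.swap_apply_left]

lemma cutSize_recolor_le [Finite V] (h : IsReattachment A G v G' u) (c : V → C) :
    cutSize G' (recolor A v u c) ≤ cutSize G c := by
  classical
  have key : 2 * cutSize G' (recolor A v u c) ≤ 2 * cutSize G c := by
    rw [two_mul_cutSize, two_mul_cutSize]
    let g : V → V → V := fun a b => if a ∉ A ∧ b ∈ A then v else a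
    have gadj : ∀ a b, G'.Adj a b → recolor A v u c a ≠ recolor A v u c b →
        (((a ∈ A ↔ b ∈ A) ∧ g a b = a ∧ g b a = b ∧ G.Adj a b ∧ c a ≠ c b) ∨
        (a ∈ A ∧ b = u ∧ g a b = a ∧ g b a = v ∧ G.Adj a v ∧ c a ≠ c v) ∨
        (b ∈ A ∧ a = u ∧ g b a = b ∧ g a b = v ∧ G.Adj v b ∧ c v ≠ c b)) := by
      intro a b hab hne
      by_cases ha : a ∈ A <;> by_cases hb : b ∈ A
      · have e : a ∈ A ↔ b ∈ A := by tauto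
        exact Or.inl ⟨e, by simp [g, ha], by simp [g, hb], (h.adj_iff a b e).2 hab,
          (recolor_ne_iff c e).1 hne⟩
      · obtain rfl := h.eq_target a b hab ha hb
        exact Or.inr (Or.inl ⟨ha, rfl, by simp [g, ha], by simp [g, ha, hb],
          (h.adj_source_iff a ha).2 hab, (h.recolor_ne_target_iff c ha).1 hne⟩)
      · obtain rfl := h.eq_target b a hab.symm hb ha
        exact Or.inr (Or.inr ⟨hb, rfl, by simp [g, hb], by simp [g, ha, hb],
          ((h.adj_source_iff b hb).2 hab.symm).symm,
          ((h.recolor_ne_target_iff c hb).1 hne.symm).symm⟩)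
      · have e : a ∈ A ↔ b ∈ A := by tauto
        exact Or.inl ⟨e, by simp [g, hb], by simp [g, ha], (h.adj_iff a b e).2 hab,
          (recolor_ne_iff c e).1 hne⟩
    refine Set.ncard_le_ncard_of_injOn (fun p => (g p.1 p.2, g p.2 p.1)) ?_ ?_ (Set.toFinite _)
    · rintro ⟨a, b⟩ ⟨hab, hne⟩
      rcases gadj a b hab hne with ⟨-, h1, h2, h3, h4⟩ | ⟨-, -, h1, h2, h3, h4⟩ |
        ⟨-, -, h1, h2, h3, h4⟩ <;> simp only [Set.mem_ofPred_eq, h1, h2] <;> exact ⟨h3, h4⟩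
    · rintro ⟨a, b⟩ ⟨hab, hne⟩ ⟨a', b'⟩ ⟨hab', hne'⟩ heq
      have hv := h.source_notMem
      simp only [Prod.mk.injEq] at heq ⊢
      obtain ⟨e1, e2⟩ := heq
      rcases gadj a b hab hne with ⟨h0, h1, h2, h3, h4⟩ | ⟨h0, h5, h1, h2, h3, h4⟩ |
        ⟨h0, h5, h1, h2, h3, h4⟩ <;>
      rcases gadj a' b' hab' hne' with ⟨k0, k1, k2, k3, k4⟩ | ⟨k0, k5, k1, k2, k3, k4⟩ |
        ⟨k0, k5, k1, k2, k3, k4⟩ <;>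
      simp only [h1, h2, k1, k2] at e1 e2 <;> grind
  omega

lemma connected (h : IsReattachment A G v G' u) (hG : G.Connected) : G'.Connected := by
  classical
  have : Nonempty V := ⟨v⟩
  refine ⟨fun a b => ?_⟩
  by_contra hab
  let c : V → Prop := fun w => G'.Reachable a w
  have hc' : ∀ p q, G'.Adj p q → c p = c q := fun p q hpq => by
    simp only [c, eq_iff_iff]
    exact ⟨fun hr => hr.trans hpq.reachable, fun hr => hr.trans hpq.symm.reachable⟩
  have hc : ∀ p q, G.Adj p q → recolor A u v c p = recolor A u v c q := by
    intro p q hpq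
    by_contra hne
    by_cases hp : p ∈ A <;> by_cases hq : q ∈ A
    · have e : p ∈ A ↔ q ∈ A := by tauto
      exact (recolor_ne_iff c e).1 hne (hc' _ _ ((h.adj_iff _ _ e).1 hpq))
    · obtain rfl := h.eq_source p q hpq hp hq
      exact (h.symm.recolor_ne_target_iff c hp).1 hne (hc' _ _ ((h.adj_source_iff p hp).1 hpq))
    · obtain rfl := h.eq_source q p hpq.symm hq hp
      exact (h.symm.recolor_ne_target_iff c hq).1 (Ne.symm hne)
        (hc' _ _ ((h.adj_source_iff q hq).1 hpq.symm))
    · have e : p ∈ A ↔ q ∈ A := by tauto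
      exact (recolor_ne_iff c e).1 hne (hc' _ _ ((h.adj_iff _ _ e).1 hpq))
  have hconst : ∀ p q, recolor A u v c p = recolor A u v c q := fun p q =>
    (mem_of_reachable_of_closed (A := {w | recolor A u v c p = recolor A u v c w})
      (fun x y hxy hx => Eq.trans hx (hc x y hxy)) (hG.preconnected p q) rfl)
  have hvu : c v = c u := by
    have := hconst v u
    rwa [recolor_of_notMem h.source_notMem, recolor_of_notMem h.target_notMem] at this
  have hrc : recolor A u v c = c := recolor_of_eq hvu.symm
  have h2 : c a = c b := by
    have := hconst a b
    rwa [hrc] at this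
  exact hab (Eq.mp h2 (SimpleGraph.Reachable.refl a))

lemma isPartitionMinimal [Finite V] {k : ℕ} (h : IsReattachment A G v G' u)
    (hG : IsPartitionMinimal k G) : IsPartitionMinimal k G' where
  connected := h.connected hG.connected
  le_cutSize c hc :=
    (hG.le_cutSize _ (recolor_surjective h.target_notMem h.source_notMem hc)).trans
      (h.symm.cutSize_recolor_le c)
  exists_cutSize_le a b hab := by
    suffices hs : ∃ c : V → Fin k, c.Surjective ∧
        recolor A v u c a ≠ recolor A v u c b ∧ cutSize G c ≤ k by
      obtain ⟨c, hc, hne, hle⟩ := hs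
      exact ⟨_, recolor_surjective h.source_notMem h.target_notMem hc, hne,
        (h.cutSize_recolor_le c).trans hle⟩
    by_cases ha : a ∈ A <;> by_cases hb : b ∈ A
    · have e : a ∈ A ↔ b ∈ A := by tauto
      obtain ⟨c, hc, hne, hle⟩ := hG.exists_cutSize_le a b ((h.adj_iff a b e).2 hab)
      exact ⟨c, hc, (recolor_ne_iff c e).2 hne, hle⟩
    · obtain rfl := h.eq_target a b hab ha hb
      obtain ⟨c, hc, hne, hle⟩ := hG.exists_cutSize_le a v ((h.adj_source_iff a ha).2 hab)
      exact ⟨c, hc, (h.recolor_ne_target_iff c ha).2 hne, hle⟩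
    · obtain rfl := h.eq_target b a hab.symm hb ha
      obtain ⟨c, hc, hne, hle⟩ := hG.exists_cutSize_le b v ((h.adj_source_iff b hb).2 hab.symm)
      exact ⟨c, hc, ((h.recolor_ne_target_iff c hb).2 hne).symm, hle⟩
    · have e : a ∈ A ↔ b ∈ A := by tauto
      obtain ⟨c, hc, hne, hle⟩ := hG.exists_cutSize_le a b ((h.adj_iff a b e).2 hab)
      exact ⟨c, hc, (recolor_ne_iff c e).2 hne, hle⟩

lemma exists_of_cutVertex {V : Type*} {A : Set V} {G : SimpleGraph V} {u v : V} (hu : u ∉ A)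
    (hv : v ∉ A) (hA : ∀ a b, G.Adj a b → a ∈ A → b ∉ A → b = v) :
    ∃ G' : SimpleGraph V, IsReattachment A G v G' u := by
  let G' : SimpleGraph V :=
    { Adj := fun a b => ((a ∈ A ↔ b ∈ A) ∧ G.Adj a b) ∨ (a ∈ A ∧ b = u ∧ G.Adj a v) ∨
        (b ∈ A ∧ a = u ∧ G.Adj b v)
      symm := ⟨fun a b h => by
        have := G.adj_comm a b
        tauto⟩
      loopless := ⟨fun a h => by
        have := G.irrefl (v := a)
        grind⟩ }
  refine ⟨G', hv, hu, ?_, hA, ?_, ?_⟩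
  · intro a b hab
    change _ ↔ _ ∨ _ ∨ _
    grind
  · rintro a b (h | h | h) ha hb
    · tauto
    · exact h.2.1
    · tauto
  · intro a ha
    change _ ↔ _ ∨ _ ∨ _
    grind

open Classical in
lemma ite_adj_eq (h : IsReattachment A G v G' u) (huv : u ≠ v) (x : V → ℝ) (a b : V) :
    (if G'.Adj a b then x b else 0) = (if G.Adj a b then x b else 0)
      + (if b = u then (if a ∈ A ∧ G.Adj a v then 1 else 0) * x u else 0)
      - (if b = v then (if a ∈ A ∧ G.Adj a v then 1 else 0) * x v else 0)
      + ((if a = u then 1 else 0) - (if a = v then 1 else 0)) *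
        ((if b ∈ A ∧ G.Adj b v then 1 else 0) * x b) := by
  have hu : ∀ w ∈ A, w ≠ u := fun w hw e => h.target_notMem (e ▸ hw)
  have hv : ∀ w ∈ A, w ≠ v := fun w hw e => h.source_notMem (e ▸ hw)
  by_cases ha : a ∈ A <;> by_cases hb : b ∈ A
  · have e : G.Adj a b ↔ G'.Adj a b := h.adj_iff a b ⟨fun _ => hb, fun _ => ha⟩
    simp [hu a ha, hv a ha, hu b hb, hv b hb, e]
  · by_cases e3 : b = u
    · subst e3
      have e4 : ¬ G.Adj a b := fun e => huv (h.eq_source a b e ha hb)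
      have e5 : G.Adj a v ↔ G'.Adj a b := h.adj_source_iff a ha
      simp [hu a ha, hv a ha, huv, ha, e4, e5]
    · have e4 : ¬ G'.Adj a b := fun e => e3 (h.eq_target a b e ha hb)
      by_cases e5 : b = v
      · subst e5
        by_cases e6 : G.Adj a b <;> simp [hu a ha, hv a ha, e3, e4, ha, e6]
      · have e6 : ¬ G.Adj a b := fun e => e5 (h.eq_source a b e ha hb)
        simp [hu a ha, hv a ha, e3, e4, e5, e6]
  · by_cases e3 : a = u
    · subst e3
      have e4 : ¬ G.Adj a b := fun e => huv (h.eq_source b a e.symm hb ha)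
      have e5 : G'.Adj a b ↔ G.Adj b v := by rw [h.adj_source_iff b hb, G'.adj_comm]
      by_cases e6 : G.Adj b v <;> simp [hu b hb, hv b hb, huv, hb, e4, e5, e6]
    · have e4 : ¬ G'.Adj a b := fun e => e3 (h.eq_target b a e.symm hb ha)
      by_cases e5 : a = v
      · subst e5
        have e7 := G.adj_comm a b
        by_cases e6 : G.Adj b a <;> simp [hu b hb, hv b hb, e3, e4, hb, e6, e7]
      · have e6 : ¬ G.Adj a b := fun e => e5 (h.eq_source b a e.symm hb ha)
        simp [hu b hb, hv b hb, e3, e4, e5, e6]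
  · have e : G.Adj a b ↔ G'.Adj a b :=
      h.adj_iff a b ⟨fun h => absurd h ha, fun h => absurd h hb⟩
    simp [ha, hb, e]

/-- Reattaching at a vertex of larger Perron weight strictly increases the spectral radius. -/
lemma specRad_lt [Fintype V] [DecidableEq V] (h : IsReattachment A G v G' u)
    (hG : G.Connected) (hA : A.Nonempty) (huv : u ≠ v) {x : V → ℝ} (hxpos : ∀ w, 0 < x w)
    (hxeig : (adjMat G).mulVec x = specRad G • x) (hx : x v ≤ x u) :
    specRad G < specRad G' := by
  classical
  let d : V → ℝ := fun a => if a ∈ A ∧ G.Adj a v then 1 else 0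
  let D : ℝ := ∑ a, d a * x a
  have hD : 0 < D := by
    obtain ⟨a, ha⟩ := hA
    obtain ⟨p, q, hpq, hp, hq⟩ := exists_adj_of_connected hG ha h.source_notMem
    obtain rfl := h.eq_source p q hpq hp hq
    refine Finset.sum_pos' (fun i _ => ?_) ⟨p, Finset.mem_univ _, ?_⟩
    · have := (hxpos i).le
      simp only [d]
      split_ifs <;> simp [this]
    · simp [d, hp, hpq, hxpos p]
  have hent : ∀ a b, (if G'.Adj a b then x b else 0) = (if G.Adj a b then x b else 0)
      + (if b = u then d a * x u else 0) - (if b = v then d a * x v else 0)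
      + ((if a = u then 1 else 0) - (if a = v then 1 else 0)) * (d b * x b) := by
    intro a b
    simp only [d]
    convert h.ite_adj_eq huv x a b
  have hmul : ∀ a, (adjMat G').mulVec x a = specRad G * x a + d a * (x u - x v)
      + ((if a = u then 1 else 0) - (if a = v then 1 else 0)) * D := by
    intro a
    have e : (adjMat G).mulVec x a = specRad G * x a := by rw [hxeig]; rfl
    rw [adjMat_mulVec_apply] at e ⊢
    simp only [hent]
    rw [Finset.sum_add_distrib, Finset.sum_sub_distrib, Finset.sum_add_distrib, e,
      ← Finset.mul_sum]
    simp only [Finset.sum_ite_eq', Finset.mem_univ, if_true]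
    ring
  have hq : x ⬝ᵥ (adjMat G').mulVec x = specRad G * (x ⬝ᵥ x) + 2 * (D * (x u - x v)) := by
    simp only [dotProduct, hmul]
    have : ∀ a, x a * (specRad G * x a + d a * (x u - x v)
        + ((if a = u then 1 else 0) - (if a = v then 1 else 0)) * D)
        = specRad G * (x a * x a) + (d a * x a) * (x u - x v)
          + ((if a = u then x a * D else 0) - (if a = v then x a * D else 0)) := by
      intro a
      split_ifs <;> ring
    simp only [this]
    rw [Finset.sum_add_distrib, Finset.sum_sub_distrib, Finset.sum_add_distrib,
      ← Finset.mul_sum, ← Finset.sum_mul]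
    simp only [Finset.sum_ite_eq', Finset.mem_univ, if_true]
    simp only [D]
    ring
  have hxx : 0 < x ⬝ᵥ x :=
    Finset.sum_pos (fun i _ => mul_pos (hxpos i) (hxpos i)) ⟨v, Finset.mem_univ v⟩
  by_contra hle
  rw [not_lt] at hle
  have hnn : 0 ≤ D * (x u - x v) := mul_nonneg hD.le (by linarith)
  have h1 : specRad G' * (x ⬝ᵥ x) ≤ specRad G * (x ⬝ᵥ x) :=
    mul_le_mul_of_nonneg_right hle hxx.le
  have h2 := adjMat_mulVec_eq_of_le G' x (by linarith)
  have h3 := hmul v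
  have h4 : d v = 0 := by simp [d]
  rw [h2, h4] at h3
  simp only [Pi.smul_apply, smul_eq_mul, if_neg huv.symm, if_true] at h3
  rw [h2, dotProduct_smul, smul_eq_mul] at hq
  have h5 : specRad G ≤ specRad G' := by
    refine le_of_mul_le_mul_right ?_ hxx
    linarith
  have h6 := le_antisymm hle h5
  rw [h6] at h3
  linarith

end IsReattachment

/-- The ordered pairs of adjacent vertices leaving `S`. -/
def outPairs {V : Type*} (G : SimpleGraph V) (S : Set V) : Set (V × V) :=
  {p | G.Adj p.1 p.2 ∧ p.1 ∈ S ∧ p.2 ∉ S}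

lemma mem_outPairs {V : Type*} {G : SimpleGraph V} {S : Set V} {a b : V} :
    (a, b) ∈ outPairs G S ↔ G.Adj a b ∧ a ∈ S ∧ b ∉ S := Iff.rfl

lemma two_le_ncard_outPairs {V : Type*} [Finite V] {G : SimpleGraph V} (hG : G.Connected)
    (hcut : ∀ v, ¬ IsCutVtx G v) (hV : 3 ≤ Nat.card V) {S : Set V} {a b : V}
    (ha : a ∈ S) (hb : b ∉ S) : 2 ≤ (outPairs G S).ncard := by
  obtain ⟨p, q, hpq, hp, hq⟩ := exists_adj_of_connected hG ha hb
  by_contra! hlt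
  have hone : ∀ r s, G.Adj r s → r ∈ S → s ∉ S → r = p ∧ s = q := by
    intro r s hrs hr hs
    have h1 : (outPairs G S).ncard ≤ 1 := by omega
    rw [Set.ncard_le_one (Set.toFinite _)] at h1
    have := h1 (r, s) ⟨hrs, hr, hs⟩ (p, q) ⟨hpq, hp, hq⟩
    simpa using this
  obtain ⟨z, hz⟩ : ∃ z, z ∉ ({p, q} : Set V) := by
    by_contra! h
    have h1 : (Set.univ : Set V) ⊆ {p, q} := fun z _ => h z
    have h2 := Set.ncard_le_ncard h1 (Set.toFinite _)
    rw [Set.ncard_univ] at h2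
    have := Set.ncard_insert_le p {q}
    rw [Set.ncard_singleton] at this
    omega
  simp only [Set.mem_insert_iff, Set.mem_singleton_iff, not_or] at hz
  by_cases hzS : z ∈ S
  · exact hcut p (isCutVtx_of_set hzS hz.1 hq hpq.ne'
      fun r s hrs hr hs => Or.inl (hone r s hrs hr hs).1)
  · exact hcut q (isCutVtx_of_set hp hpq.ne hzS hz.2
      fun r s hrs hr hs => Or.inr (hone r s hrs hr hs).2)

lemma eq_or_eq_of_ncard_eq_two {α : Type*} [Finite α] {s : Set α} (hs : s.ncard = 2)
    {p q r : α} (hp : p ∈ s) (hq : q ∈ s) (hpq : p ≠ q) (hr : r ∈ s) : r = p ∨ r = q := by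
  have h : ({p, q} : Set α) = s := Set.eq_of_subset_of_ncard_le
    (Set.insert_subset hp (Set.singleton_subset_iff.2 hq))
    (by rw [hs, Set.ncard_pair hpq]) (Set.toFinite _)
  rw [← h] at hr
  simpa using hr

lemma two_mul_cutSize_eq_sum {V C : Type*} [Finite V] [Fintype C] (G : SimpleGraph V)
    (c : V → C) : 2 * cutSize G c = ∑ i, (outPairs G (c ⁻¹' {i})).ncard := by
  classical
  have := Fintype.ofFinite V
  rw [two_mul_cutSize]
  simp only [Set.ncard_eq_toFinset_card']
  rw [Finset.card_eq_sum_card_fiberwise (f := fun p => c p.1) (t := Finset.univ)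
    (fun _ _ => Finset.mem_coe.2 (Finset.mem_univ _))]
  refine Finset.sum_congr rfl fun i _ => congrArg _ ?_
  ext ⟨a, b⟩
  rw [Finset.mem_filter, Set.mem_toFinset, Set.mem_toFinset, mem_outPairs]
  constructor
  · rintro ⟨⟨h1, h2⟩, rfl⟩
    exact ⟨h1, rfl, fun h => h2 h.symm⟩
  · rintro ⟨h1, rfl, h2⟩
    exact ⟨⟨h1, fun h => h2 h.symm⟩, rfl⟩

/-- The endpoints of an edge `uv` lie in disjoint sets `S`, `T` with two outgoing edges each,
which do not cover the whole graph. -/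
structure IsBeadPair {V : Type*} (G : SimpleGraph V) (u v : V) (S T : Set V) : Prop where
  mem_left : u ∈ S
  mem_right : v ∈ T
  disjoint : ∀ a ∈ S, a ∉ T
  exists_notMem : ∃ z, z ∉ S ∧ z ∉ T
  ncard_left : (outPairs G S).ncard = 2
  ncard_right : (outPairs G T).ncard = 2

lemma IsPartitionMinimal.exists_isBeadPair {V : Type*} [Finite V] {k : ℕ} {G : SimpleGraph V}
    (hk : 3 ≤ k) (hG : IsPartitionMinimal k G) (hV : 3 ≤ Nat.card V)
    (hcut : ∀ v, ¬ IsCutVtx G v) {u v : V} (huv : G.Adj u v) :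
    ∃ S T, IsBeadPair G u v S T := by
  classical
  obtain ⟨c, hc, hne, hle⟩ := hG.exists_cutSize_le u v huv
  have hsum := two_mul_cutSize_eq_sum G c
  have h2 : ∀ i, 2 ≤ (outPairs G (c ⁻¹' {i})).ncard := by
    intro i
    obtain ⟨a, ha⟩ := hc i
    obtain ⟨b, hb⟩ : ∃ b, c b ≠ i := by
      by_cases h : c u = i
      · exact ⟨v, fun h' => hne (h.trans h'.symm)⟩
      · exact ⟨u, h⟩
    exact two_le_ncard_outPairs hG.connected hcut hV (S := c ⁻¹' {i}) ha hb
  have heq : ∀ i, (outPairs G (c ⁻¹' {i})).ncard = 2 := by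
    have h3 : ∑ _i : Fin k, 2 = ∑ i, (outPairs G (c ⁻¹' {i})).ncard := by
      refine le_antisymm (Finset.sum_le_sum fun i _ => h2 i) ?_
      rw [← hsum]
      simp
      omega
    intro i
    exact ((Finset.sum_eq_sum_iff_of_le fun i _ => h2 i).1 h3 i (Finset.mem_univ _)).symm
  refine ⟨c ⁻¹' {c u}, c ⁻¹' {c v}, rfl, rfl, ?_, ?_, heq _, heq _⟩
  · intro a ha hb
    exact hne (Eq.trans (Eq.symm ha) hb)
  · have h3 : ∃ i, i ∉ ({c u, c v} : Finset (Fin k)) := by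
      by_contra! h
      have h4 := Finset.card_le_card (fun i _ => h i : Finset.univ ⊆ ({c u, c v} : Finset _))
      have := Finset.card_le_two (a := c u) (b := c v)
      simp at h4
      omega
    obtain ⟨i, hi⟩ := h3
    obtain ⟨z, rfl⟩ := hc i
    exact ⟨z, by simpa using hi⟩

lemma IsBeadPair.false_of_common_edge {V : Type*} [Finite V] {G : SimpleGraph V}
    (hG : G.Connected) {u v s t : V} {S T : Set V} (h : IsBeadPair G u v S T)
    (huv : G.Adj u v) (hst : G.Adj s t) (hs : s ∈ S) (ht : t ∈ T)
    (hne : (u, v) ≠ (s, t)) : False := by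
  have hd : ∀ a ∈ T, a ∉ S := fun a ha hb => h.disjoint a hb ha
  obtain ⟨z, hzS, hzT⟩ := h.exists_notMem
  have hz : z ∉ S ∪ T := by
    rintro (h | h)
    · exact hzS h
    · exact hzT h
  refine hz (mem_of_reachable_of_closed ?_ (hG.preconnected u z) (Or.inl h.mem_left))
  intro a b hab hm
  by_contra hb
  have hbS : b ∉ S := fun h => hb (Or.inl h)
  have hbT : b ∉ T := fun h => hb (Or.inr h)
  rcases hm with ha | ha
  · rcases eq_or_eq_of_ncard_eq_two h.ncard_left (p := (u, v)) (q := (s, t)) (r := (a, b))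
      ⟨huv, h.mem_left, hd v h.mem_right⟩ ⟨hst, hs, hd t ht⟩ hne ⟨hab, ha, hbS⟩ with e | e
    · obtain ⟨rfl, rfl⟩ := Prod.mk.inj e
      exact hbT h.mem_right
    · obtain ⟨rfl, rfl⟩ := Prod.mk.inj e
      exact hbT ht
  · rcases eq_or_eq_of_ncard_eq_two h.ncard_right (p := (v, u)) (q := (t, s)) (r := (a, b))
      ⟨huv.symm, h.mem_right, h.disjoint u h.mem_left⟩ ⟨hst.symm, ht, h.disjoint s hs⟩
      (fun e => hne (by obtain ⟨rfl, rfl⟩ := Prod.mk.inj e; rfl)) ⟨hab, ha, hbT⟩ with e | e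
    · obtain ⟨rfl, rfl⟩ := Prod.mk.inj e
      exact hbS h.mem_left
    · obtain ⟨rfl, rfl⟩ := Prod.mk.inj e
      exact hbS hs

lemma false_of_outPairs_subset_pair {V : Type*} {G : SimpleGraph V} {u a b z : V}
    (hcut : ¬ IsCutVtx G u) (hdeg : ∀ a b, ∃ w, G.Adj u w ∧ w ≠ a ∧ w ≠ b) {S : Set V}
    (hu : u ∈ S) (hz : z ∉ S)
    (hS : ∀ p q, G.Adj p q → p ∈ S → q ∉ S → p = u ∧ (q = a ∨ q = b)) : False := by
  obtain ⟨w, huw, hwa, hwb⟩ := hdeg a b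
  by_cases hw : w ∈ S
  · exact hcut (isCutVtx_of_set hw huw.ne' hz (fun e => hz (e ▸ hu))
      fun p q hpq hp hq => Or.inl (hS p q hpq hp hq).1)
  · rcases (hS u w huw hu hw).2 with h | h
    · exact hwa h
    · exact hwb h

section NoCutVertex

variable {V : Type*} [Finite V] {k : ℕ} {G : SimpleGraph V} {u : V}

lemma IsBeadPair.mem_left_of_adj {v w : V} {S T : Set V} (h : IsBeadPair G u v S T)
    (huv : G.Adj u v) (hcut : ¬ IsCutVtx G u)
    (hdeg : ∀ a b, ∃ w, G.Adj u w ∧ w ≠ a ∧ w ≠ b) (huw : G.Adj u w) (hvw : v ≠ w) : w ∈ S := by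
  by_contra hw
  have hv : v ∉ S := fun hv => h.disjoint v hv h.mem_right
  refine false_of_outPairs_subset_pair hcut hdeg (a := v) (b := w) h.mem_left hw ?_
  intro p q hpq hp hq
  rcases eq_or_eq_of_ncard_eq_two h.ncard_left (p := (u, v)) (q := (u, w)) (r := (p, q))
      ⟨huv, h.mem_left, hv⟩ ⟨huw, h.mem_left, hw⟩
      (by simpa using hvw) ⟨hpq, hp, hq⟩ with e | e
  · obtain ⟨rfl, rfl⟩ := Prod.mk.inj e
    exact ⟨rfl, Or.inl rfl⟩
  · obtain ⟨rfl, rfl⟩ := Prod.mk.inj e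
    exact ⟨rfl, Or.inr rfl⟩

lemma IsPartitionMinimal.no_triangle (hk : 3 ≤ k) (hG : IsPartitionMinimal k G)
    (hV : 3 ≤ Nat.card V) (hcut : ∀ v, ¬ IsCutVtx G v)
    (hdeg : ∀ a b, ∃ w, G.Adj u w ∧ w ≠ a ∧ w ≠ b) {v w : V} (huv : G.Adj u v)
    (huw : G.Adj u w) : ¬ G.Adj v w := by
  intro hvw
  obtain ⟨S, T, h⟩ := hG.exists_isBeadPair hk hV hcut huv
  exact h.false_of_common_edge hG.connected huv hvw.symm
    (h.mem_left_of_adj huv (hcut u) hdeg huw hvw.ne) h.mem_right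
    (by simpa using fun e => absurd e huw.ne)

lemma IsBeadPair.outPairs_of_square (hG : G.Connected) {v v' w : V} {S T : Set V}
    (h : IsBeadPair G u v S T)
    (hcut : ¬ IsCutVtx G u) (hdeg : ∀ a b, ∃ w, G.Adj u w ∧ w ≠ a ∧ w ≠ b)
    (huv : G.Adj u v) (huv' : G.Adj u v') (hvv' : v ≠ v') (hvw : G.Adj v w) (hv'w : G.Adj v' w)
    (hwu : w ≠ u) :
    v' ∈ S ∧ w ∉ S ∧ w ∉ T ∧
    (∀ p q, G.Adj p q → p ∈ S → q ∉ S → (p = u ∧ q = v) ∨ (p = v' ∧ q = w)) ∧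
    (∀ p q, G.Adj p q → p ∈ T → q ∉ T → (p = v ∧ q = u) ∨ (p = v ∧ q = w)) := by
  have hv' := h.mem_left_of_adj huv hcut hdeg huv' hvv'
  have hv : v ∉ S := fun hv => h.disjoint v hv h.mem_right
  have hwS : w ∉ S := fun hw =>
    h.false_of_common_edge hG huv hvw.symm hw h.mem_right (by simpa using hwu.symm)
  have hwT : w ∉ T := fun hw =>
    h.false_of_common_edge hG huv hv'w hv' hw (by simpa using fun e => absurd e huv'.ne)
  refine ⟨hv', hwS, hwT, fun p q hpq hp hq => ?_, fun p q hpq hp hq => ?_⟩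
  · have := eq_or_eq_of_ncard_eq_two h.ncard_left (p := (u, v)) (q := (v', w)) (r := (p, q))
      ⟨huv, h.mem_left, hv⟩ ⟨hv'w, hv', hwS⟩
      (by simpa using fun e => absurd e huv'.ne) ⟨hpq, hp, hq⟩
    simpa using this
  · have := eq_or_eq_of_ncard_eq_two h.ncard_right (p := (v, u)) (q := (v, w)) (r := (p, q))
      ⟨huv.symm, h.mem_right, h.disjoint u h.mem_left⟩ ⟨hvw, h.mem_right, hwT⟩
      (by simpa using hwu.symm) ⟨hpq, hp, hq⟩
    simpa using this

lemma IsPartitionMinimal.no_square (hk : 3 ≤ k) (hG : IsPartitionMinimal k G)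
    (hV : 3 ≤ Nat.card V) (hcut : ∀ v, ¬ IsCutVtx G v)
    (hdeg : ∀ a b, ∃ w, G.Adj u w ∧ w ≠ a ∧ w ≠ b) {v v' w : V} (huv : G.Adj u v)
    (huv' : G.Adj u v') (hvv' : v ≠ v') (hvw : G.Adj v w) (hv'w : G.Adj v' w) : w = u := by
  by_contra hwu
  obtain ⟨S, T, h⟩ := hG.exists_isBeadPair hk hV hcut huv
  obtain ⟨S', T', h'⟩ := hG.exists_isBeadPair hk hV hcut huv'
  obtain ⟨-, -, -, -, hT⟩ :=
    h.outPairs_of_square hG.connected (hcut u) hdeg huv huv' hvv' hvw hv'w hwu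
  obtain ⟨-, hwS', -, hS', -⟩ :=
    h'.outPairs_of_square hG.connected (hcut u) hdeg huv' huv hvv'.symm hv'w hvw hwu
  refine false_of_outPairs_subset_pair (hcut u) hdeg (S := S' \ T) (a := v) (b := v') (z := w)
    ⟨h'.mem_left, h.disjoint u h.mem_left⟩ (fun hw => hwS' hw.1) ?_
  rintro p q hpq ⟨hpS, hpT⟩ hq
  by_cases hqS : q ∈ S'
  · have hqT : q ∈ T := by
      by_contra hqT
      exact hq ⟨hqS, hqT⟩
    rcases hT q p hpq.symm hqT hpT with ⟨rfl, rfl⟩ | ⟨rfl, rfl⟩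
    · exact ⟨rfl, Or.inl rfl⟩
    · exact absurd hpS hwS'
  · rcases hS' p q hpq hpS hqS with ⟨rfl, rfl⟩ | ⟨rfl, rfl⟩
    · exact ⟨rfl, Or.inr rfl⟩
    · exact absurd h.mem_right hpT

end NoCutVertex

/-- If no vertex has two walks of length two from `u`, except `u` itself, and `u` lies in no
triangle, then the spectral radius is at most that of the star. -/
lemma specRad_sq_le_of_no_short_cycle {V : Type*} [Fintype V] [DecidableEq V]
    {G : SimpleGraph V} {u : V} {x : V → ℝ} (hxpos : ∀ v, 0 < x v)
    (hxeig : (adjMat G).mulVec x = specRad G • x) (hu : ∀ v, x v ≤ x u)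
    (htri : ∀ v w, G.Adj u v → G.Adj u w → ¬ G.Adj v w)
    (hsq : ∀ v v' w, G.Adj u v → G.Adj u v' → v ≠ v' → G.Adj v w → G.Adj v' w → w = u) :
    specRad G ^ 2 ≤ Fintype.card V - 1 := by
  classical
  have e : ∀ a, specRad G * x a = ∑ b, if G.Adj a b then x b else 0 := fun a => by
    rw [← adjMat_mulVec_apply, hxeig]; rfl
  have h1 : specRad G ^ 2 * x u = ∑ v, ∑ w, if G.Adj u v ∧ G.Adj v w then x w else 0 := by
    rw [pow_two, mul_assoc, e u, Finset.mul_sum]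
    refine Finset.sum_congr rfl fun v _ => ?_
    by_cases h : G.Adj u v
    · simp [h, e v]
    · simp [h]
  let P : Finset (V × V) := Finset.univ.filter fun p => G.Adj u p.1 ∧ G.Adj p.1 p.2
  have h2 : specRad G ^ 2 * x u ≤ P.card * x u := by
    rw [h1, ← Fintype.sum_prod_type', ← Finset.sum_filter, ← nsmul_eq_mul]
    exact Finset.sum_le_card_nsmul _ _ _ fun p _ => hu p.2
  have h3 : P.card ≤ (Finset.univ.erase u).card := by
    refine Finset.card_le_card_of_injOn (fun p => if p.2 = u then p.1 else p.2) ?_ ?_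
    · rintro ⟨v, w⟩ hp
      simp only [P, Finset.coe_filter, Finset.mem_univ, true_and, Set.mem_ofPred_eq] at hp
      simp only [Finset.coe_erase, Finset.coe_univ, Set.mem_sdiff, Set.mem_univ, true_and,
        Set.mem_singleton_iff]
      split_ifs with h
      · exact hp.1.ne'
      · exact h
    · rintro ⟨v, w⟩ hp ⟨v', w'⟩ hp' heq
      simp only [P, Finset.coe_filter, Finset.mem_univ, true_and, Set.mem_ofPred_eq] at hp hp'
      simp only at heq
      split_ifs at heq with h h' h'
      · rw [heq, h, h']
      · exact absurd hp'.2 (by rw [← heq]; exact htri _ _ hp'.1 hp.1)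
      · exact absurd hp.2 (by rw [heq]; exact htri _ _ hp.1 hp'.1)
      · subst heq
        by_contra hne
        exact h (hsq v v' w hp.1 hp'.1 (fun e => hne (by rw [e])) hp.2 hp'.2)
  have h4 : (P.card : ℝ) ≤ Fintype.card V - 1 := by
    rw [Finset.card_erase_of_mem (Finset.mem_univ _), Finset.card_univ] at h3
    have : 1 ≤ Fintype.card V := Fintype.card_pos_iff.2 ⟨u⟩
    have h5 : (P.card : ℝ) + 1 ≤ Fintype.card V := by
      exact_mod_cast (by omega : P.card + 1 ≤ Fintype.card V)
    linarith
  exact (le_of_mul_le_mul_right h2 (hxpos u)).trans h4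

lemma specRad_le_two_of_adj_subset_pair {V : Type*} [Fintype V] [DecidableEq V]
    {G : SimpleGraph V} {u a b : V} {x : V → ℝ} (hxpos : ∀ v, 0 < x v)
    (hxeig : (adjMat G).mulVec x = specRad G • x) (hu : ∀ v, x v ≤ x u)
    (hdeg : ∀ w, G.Adj u w → w = a ∨ w = b) : specRad G ≤ 2 := by
  classical
  have e : specRad G * x u = ∑ b, if G.Adj u b then x b else 0 := by
    rw [← adjMat_mulVec_apply, hxeig]; rfl
  have h2 : specRad G * x u ≤ 2 * x u := by
    rw [e, ← Finset.sum_filter]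
    refine (Finset.sum_le_card_nsmul _ _ _ fun p _ => hu p).trans ?_
    rw [nsmul_eq_mul]
    refine mul_le_mul_of_nonneg_right ?_ (hxpos u).le
    have h3 : (Finset.univ.filter fun w => G.Adj u w) ⊆ {a, b} := fun w hw => by
      simpa using hdeg w (by simpa using hw)
    exact_mod_cast (Finset.card_le_card h3).trans Finset.card_le_two
  exact le_of_mul_le_mul_right h2 (hxpos u)

/-- The complete bipartite graph `K_{2,m}` on hubs `inl true`, `inl false`, with `p` pendant
vertices attached to the hub `inl true`. -/
def pendantBipartite (m p : ℕ) : SimpleGraph (Bool ⊕ (Fin m ⊕ Fin p)) where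
  Adj a b := match a, b with
    | .inl true, .inr _ => True
    | .inl false, .inr (.inl _) => True
    | .inr _, .inl true => True
    | .inr (.inl _), .inl false => True
    | _, _ => False
  symm := ⟨by rintro (_ | _) (_ | _) <;> grind⟩
  loopless := ⟨by rintro (_ | _) <;> grind⟩

namespace pendantBipartite

variable {m p : ℕ}

lemma adj_hub (l : Fin m ⊕ Fin p) : (pendantBipartite m p).Adj (.inl true) (.inr l) := trivial

lemma adj_middle (a : Fin m) : (pendantBipartite m p).Adj (.inl false) (.inr (.inl a)) := trivial

lemma adj_induction {P : (Bool ⊕ (Fin m ⊕ Fin p)) → (Bool ⊕ (Fin m ⊕ Fin p)) → Prop}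
    (hsymm : ∀ a b, P a b → P b a) (hhub : ∀ l, P (.inl true) (.inr l))
    (hmid : ∀ a, P (.inl false) (.inr (.inl a))) {a b : Bool ⊕ (Fin m ⊕ Fin p)}
    (hab : (pendantBipartite m p).Adj a b) : P a b := by
  rcases a with (_ | _) | (a | a) <;> rcases b with (_ | _) | (b | b) <;>
    first
    | exact hab.elim
    | exact hhub _
    | exact hmid _
    | exact hsymm _ _ (hhub _)
    | exact hsymm _ _ (hmid _)

lemma connected (hm : 0 < m) : (pendantBipartite m p).Connected := by
  have h : ∀ a, (pendantBipartite m p).Reachable (.inl true) a := by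
    rintro ((_ | _) | l)
    · exact (adj_hub (.inl ⟨0, hm⟩)).reachable.trans (adj_middle ⟨0, hm⟩).symm.reachable
    · rfl
    · exact (adj_hub l).reachable
  have : Nonempty (Bool ⊕ (Fin m ⊕ Fin p)) := ⟨.inl true⟩
  exact ⟨fun a b => (h a).symm.trans (h b)⟩

open Classical in
/-- The outer vertices coloured differently from the main hub. -/
noncomputable def hubCut {C : Type*} (c : Bool ⊕ (Fin m ⊕ Fin p) → C) :
    Finset (Fin m ⊕ Fin p) :=
  Finset.univ.filter fun l => c (.inl true) ≠ c (.inr l)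

lemma mem_hubCut {C : Type*} {c : Bool ⊕ (Fin m ⊕ Fin p) → C} {l : Fin m ⊕ Fin p} :
    l ∈ hubCut c ↔ c (.inl true) ≠ c (.inr l) := by
  simp [hubCut]

open Classical in
/-- The middle vertices coloured differently from the second hub. -/
noncomputable def middleCut {C : Type*} (c : Bool ⊕ (Fin m ⊕ Fin p) → C) : Finset (Fin m) :=
  Finset.univ.filter fun a => c (.inl false) ≠ c (.inr (.inl a))

lemma cutSize_eq {C : Type*} (c : Bool ⊕ (Fin m ⊕ Fin p) → C) :
    cutSize (pendantBipartite m p) c = (hubCut c).card + (middleCut c).card := by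
  classical
  let f : (Fin m ⊕ Fin p) ⊕ Fin m → Sym2 (Bool ⊕ (Fin m ⊕ Fin p)) := fun s => match s with
    | .inl l => s(.inl true, .inr l)
    | .inr a => s(.inl false, .inr (.inl a))
  have hf : f.Injective := by
    rintro (l | l) (l' | l') h <;> simp [f] at h <;> rw [h]
  have h : (cutGraph (pendantBipartite m p) c).edgeSet
      = f '' ((hubCut c).disjSum (middleCut c) : Finset _) := by
    ext s
    induction s with
    | h a b =>
      constructor
      · rintro ⟨hab, hne⟩
        revert hne
        refine adj_induction (P := fun a b => c a ≠ c b → s(a, b) ∈ f '' _) ?_ ?_ ?_ hab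
        · intro a b h hne
          rw [Sym2.eq_swap]
          exact h hne.symm
        · intro l hne
          exact ⟨.inl l, by simpa [hubCut] using hne, rfl⟩
        · intro l hne
          exact ⟨.inr l, by simpa [middleCut] using hne, rfl⟩
      · rintro ⟨l | l, hl, hs⟩
        · rw [← hs]
          exact ⟨adj_hub l, by simpa [hubCut] using hl⟩
        · rw [← hs]
          exact ⟨adj_middle l, by simpa [middleCut] using hl⟩
  rw [cutSize, h, Set.ncard_image_of_injective _ hf, Set.ncard_coe_finset, Finset.card_disjSum]

lemma le_cutSize (hm : 3 ≤ m) (c : Bool ⊕ (Fin m ⊕ Fin p) → Fin (p + 2)) (hc : c.Surjective) :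
    p + 2 ≤ cutSize (pendantBipartite m p) c := by
  classical
  rw [cutSize_eq]
  have hE : ∀ l, l ∈ hubCut c ↔ c (.inl true) ≠ c (.inr l) := by simp [hubCut]
  have hM : ∀ a, a ∈ middleCut c ↔ c (.inl false) ≠ c (.inr (.inl a)) := by simp [middleCut]
  have hcol : ∀ i, i = c (.inl true) ∨ i = c (.inl false) ∨
      i ∈ (hubCut c).image fun l => c (.inr l) := by
    intro i
    obtain ⟨(_ | _) | l, rfl⟩ := hc i
    · exact Or.inr (Or.inl rfl)
    · exact Or.inl rfl
    · by_cases h : c (.inl true) = c (.inr l)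
      · exact Or.inl h.symm
      · exact Or.inr (Or.inr (Finset.mem_image.2 ⟨l, (hE l).2 h, rfl⟩))
  have hcard : (Finset.univ : Finset (Fin (p + 2))).card = p + 2 := by simp
  have hi := Finset.card_image_le (s := hubCut c) (f := fun l => c (.inr l))
  by_cases hhub : c (.inl true) = c (.inl false)
  · have h1 : p + 1 ≤ (hubCut c).card := by
      have h2 : Finset.univ ⊆ insert (c (.inl true)) ((hubCut c).image fun l => c (.inr l)) := by
        intro i _
        have := hcol i
        rw [← hhub] at this
        simp only [Finset.mem_insert]
        tauto
      have h3 := Finset.card_le_card h2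
      have h4 := Finset.card_insert_le (c (.inl true)) ((hubCut c).image fun l => c (.inr l))
      omega
    have h2 : ∃ a : Fin m, Sum.inl a ∈ hubCut c := by
      by_contra! h
      have h3 : hubCut c ⊆ Finset.univ.image (Sum.inr : Fin p → Fin m ⊕ Fin p) := by
        rintro (a | b) hl
        · exact absurd hl (h a)
        · simp
      have h4 := (Finset.card_le_card h3).trans Finset.card_image_le
      simp at h4
      omega
    obtain ⟨a, ha⟩ := h2
    have h3 : 0 < (middleCut c).card := Finset.card_pos.2
      ⟨a, (hM a).2 (by rw [← hhub]; exact (hE _).1 ha)⟩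
    omega
  · by_cases hmid : 2 ≤ (middleCut c).card
    · have h2 : Finset.univ ⊆ insert (c (.inl true)) (insert (c (.inl false))
          ((hubCut c).image fun l => c (.inr l))) := by
        intro i _
        have := hcol i
        simp only [Finset.mem_insert]
        tauto
      have h3 := Finset.card_le_card h2
      have h4 := Finset.card_insert_le (c (.inl true)) (insert (c (.inl false))
        ((hubCut c).image fun l => c (.inr l)))
      have h5 := Finset.card_insert_le (c (.inl false)) ((hubCut c).image fun l => c (.inr l))
      omega
    · have h1 : 1 < (Finset.univ \ middleCut c).card := by
        have := Finset.le_card_sdiff (middleCut c) Finset.univ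
        rw [Finset.card_univ, Fintype.card_fin] at this
        omega
      obtain ⟨a, ha, b, hb, hab⟩ := Finset.one_lt_card.1 h1
      have ha' : c (.inl false) = c (.inr (.inl a)) := by simpa [hM] using ha
      have hb' : c (.inl false) = c (.inr (.inl b)) := by simpa [hM] using hb
      have haE : Sum.inl a ∈ hubCut c := (hE _).2 (by rw [← ha']; exact hhub)
      have hbE : Sum.inl b ∈ hubCut c := (hE _).2 (by rw [← hb']; exact hhub)
      have h2 : Finset.univ ⊆ insert (c (.inl true))
          (((hubCut c).erase (.inl a)).image fun l => c (.inr l)) := by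
        intro i _
        have hbm : c (.inr (.inl b)) ∈ ((hubCut c).erase (.inl a)).image fun l => c (.inr l) :=
          Finset.mem_image.2 ⟨.inl b, Finset.mem_erase.2 ⟨by simpa using hab.symm, hbE⟩, rfl⟩
        rw [Finset.mem_insert]
        rcases hcol i with h | h | h
        · exact Or.inl h
        · exact Or.inr (by rw [h, hb']; exact hbm)
        · obtain ⟨l, hl, rfl⟩ := Finset.mem_image.1 h
          by_cases hla : l = .inl a
          · subst hla
            exact Or.inr (by rw [← ha', hb']; exact hbm)
          · exact Or.inr (Finset.mem_image.2 ⟨l, Finset.mem_erase.2 ⟨hla, hl⟩, rfl⟩)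
      have h3 := Finset.card_le_card h2
      have h4 := Finset.card_insert_le (c (.inl true))
        (((hubCut c).erase (.inl a)).image fun l => c (.inr l))
      have h5 := Finset.card_image_le (s := (hubCut c).erase (.inl a)) (f := fun l => c (.inr l))
      have h6 := Finset.card_erase_add_one haE
      omega

/-- The colouring isolating the middle vertex `a` and all pendant vertices. -/
def isolate (a : Fin m) : Bool ⊕ (Fin m ⊕ Fin p) → Fin (p + 2)
  | .inl _ => 0
  | .inr (.inl b) => if b = a then 1 else 0
  | .inr (.inr j) => j.succ.succ

lemma isolate_surjective (a : Fin m) : (isolate (p := p) a).Surjective := by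
  intro i
  induction i using Fin.cases with
  | zero => exact ⟨.inl true, rfl⟩
  | succ i =>
    induction i using Fin.cases with
    | zero => exact ⟨.inr (.inl a), by simp [isolate]⟩
    | succ i => exact ⟨.inr (.inr i), rfl⟩

lemma cutSize_isolate (a : Fin m) :
    cutSize (pendantBipartite m p) (isolate a) ≤ p + 2 := by
  classical
  rw [cutSize_eq]
  have h1 : hubCut (isolate (p := p) a) ⊆
      insert (.inl a) (Finset.univ.image (Sum.inr : Fin p → Fin m ⊕ Fin p)) := by
    rintro (b | b) hb
    · have : b = a := by
        by_contra h
        exact mem_hubCut.1 hb (by simp [isolate, h])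
      simp [this]
    · simp
  have h2 : middleCut (isolate (p := p) a) ⊆ {a} := by
    intro b hb
    by_contra h
    rw [Finset.mem_singleton] at h
    simp [middleCut, isolate, h] at hb
  have h3 := Finset.card_le_card h1
  have h4 := Finset.card_le_card h2
  have h5 := Finset.card_insert_le (Sum.inl a)
    (Finset.univ.image (Sum.inr : Fin p → Fin m ⊕ Fin p))
  have h6 := Finset.card_image_le (s := Finset.univ) (f := (Sum.inr : Fin p → Fin m ⊕ Fin p))
  rw [Finset.card_singleton] at h4
  rw [Finset.card_univ, Fintype.card_fin] at h6
  omega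

lemma isPartitionMinimal (hm : 3 ≤ m) : IsPartitionMinimal (p + 2) (pendantBipartite m p) where
  connected := connected (by omega)
  le_cutSize := le_cutSize hm
  exists_cutSize_le a b hab := by
    suffices h : ∃ i : Fin m, isolate (p := p) i a ≠ isolate i b by
      obtain ⟨i, hi⟩ := h
      exact ⟨isolate i, isolate_surjective i, hi, cutSize_isolate i⟩
    refine adj_induction (P := fun a b => ∃ i : Fin m, isolate (p := p) i a ≠ isolate i b)
      ?_ ?_ ?_ hab
    · rintro a b ⟨i, hi⟩
      exact ⟨i, hi.symm⟩
    · rintro (b | b)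
      · exact ⟨b, by simp [isolate]⟩
      · exact ⟨⟨0, by omega⟩, fun h => Fin.succ_ne_zero b.succ h.symm⟩
    · exact fun b => ⟨b, by simp [isolate]⟩

lemma sqrt_le_specRad (hm : 0 < m) :
    Real.sqrt (2 * m) ≤ specRad (pendantBipartite m p) := by
  classical
  let y : Bool ⊕ (Fin m ⊕ Fin p) → ℝ
    | .inl _ => Real.sqrt (2 * m)
    | .inr (.inl _) => 2
    | .inr (.inr _) => 0
  have h := dotProduct_adjMat_mulVec_le (pendantBipartite m p) y
  have hs : Real.sqrt (2 * m) * Real.sqrt (2 * m) = 2 * m := Real.mul_self_sqrt (by positivity)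
  have hm' : (0 : ℝ) < m := by exact_mod_cast hm
  have e1 : y ⬝ᵥ y = 8 * m := by
    simp only [dotProduct, Fintype.sum_sum_type, Fintype.sum_bool, y, hs]
    simp
    ring
  have e2 : y ⬝ᵥ (adjMat (pendantBipartite m p)).mulVec y = Real.sqrt (2 * m) * (8 * m) := by
    simp only [dotProduct, adjMat_mulVec_apply, Fintype.sum_sum_type, Fintype.sum_bool, y,
      pendantBipartite]
    simp
    ring
  rw [e1, e2] at h
  exact le_of_mul_le_mul_right h (by positivity)

end pendantBipartite

lemma IsPartitionMinimal.exists_isCutVtx_of_maximal {k n : ℕ} (hk : 3 ≤ k) (hn : 4 * k ≤ n)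
    {V : Type} [Fintype V] [DecidableEq V] {G : SimpleGraph V} (hcard : Fintype.card V = n)
    (hG : IsPartitionMinimal k G)
    (hmax : ∀ (W : Type) [Fintype W] [DecidableEq W] (H : SimpleGraph W),
      Fintype.card W = n → IsMinimallyKLEdgeConnected k k H → specRad H ≤ specRad G)
    {x : V → ℝ} (hxpos : ∀ v, 0 < x v) (hxeig : (adjMat G).mulVec x = specRad G • x)
    {u : V} (hu : ∀ v, x v ≤ x u) : ∃ v, IsCutVtx G v := by
  by_contra! hcut
  have hV : 3 ≤ Nat.card V := by rw [Nat.card_eq_fintype_card]; omega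
  obtain ⟨p, rfl⟩ : ∃ p, k = p + 2 := ⟨k - 2, by omega⟩
  obtain ⟨m, rfl⟩ : ∃ m, n = 2 + (m + p) := ⟨n - 2 - p, by omega⟩
  have hW : Fintype.card (Bool ⊕ (Fin m ⊕ Fin p)) = 2 + (m + p) := by simp
  have hlow := (pendantBipartite.sqrt_le_specRad (m := m) (p := p) (by omega)).trans
    (hmax _ _ hW ((isMinimallyKLEdgeConnected_iff_isPartitionMinimal _ (by omega)
      (by rw [Nat.card_eq_fintype_card]; omega)).2
      (pendantBipartite.isPartitionMinimal (by omega))))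
  have hsq : (2 * m : ℝ) ≤ specRad G ^ 2 := by
    rw [← Real.sq_sqrt (show (0 : ℝ) ≤ 2 * m by positivity)]
    exact pow_le_pow_left₀ (Real.sqrt_nonneg _) hlow 2
  have hpm : (3 * p + 6 : ℝ) ≤ m := by exact_mod_cast (by omega : 3 * p + 6 ≤ m)
  have hp : (0 : ℝ) ≤ p := Nat.cast_nonneg p
  by_cases hdeg : ∀ a b, ∃ w, G.Adj u w ∧ w ≠ a ∧ w ≠ b
  · have := specRad_sq_le_of_no_short_cycle hxpos hxeig hu
      (fun v w => hG.no_triangle hk hV hcut hdeg)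
      (fun v v' w => hG.no_square hk hV hcut hdeg)
    rw [hcard] at this
    push_cast at this
    linarith
  · push Not at hdeg
    obtain ⟨a, b, hab⟩ := hdeg
    have h2 := specRad_le_two_of_adj_subset_pair (a := a) (b := b) hxpos hxeig hu
      (fun w hw => or_iff_not_imp_left.2 (hab w hw))
    have h0 := (Real.sqrt_nonneg _).trans hlow
    nlinarith

/-- Let `k ≥ 3` and `n ≥ 4k`, let `G` be a graph attaining the maximum spectral radius
among all minimally `(k,k)`-edge-connected graphs of order `n`, and let `x` be the Perron
eigenvector of the adjacency matrix of `G`, with `u` a vertex of maximal entry.  Then `u`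
is the unique cut vertex of `G`. -/
theorem unique_cut_vertex_of_order_extremal_graph (k n : ℕ) (hk : 3 ≤ k) (hn : 4 * k ≤ n)
    {V : Type} [Fintype V] [DecidableEq V] (G : SimpleGraph V)
    (hcard : Fintype.card V = n)
    (hG : IsMinimallyKLEdgeConnected k k G)
    (hmax : ∀ (W : Type) [Fintype W] [DecidableEq W] (H : SimpleGraph W),
      Fintype.card W = n → IsMinimallyKLEdgeConnected k k H → specRad H ≤ specRad G)
    (x : V → ℝ) (hxpos : ∀ v, 0 < x v)
    (hxeig : Matrix.mulVec (adjMat G) x = specRad G • x)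
    (u : V) (hu : ∀ v, x v ≤ x u) :
    IsCutVtx G u ∧ ∀ v, IsCutVtx G v → v = u := by
  have hkV : k ≤ Nat.card V := by rw [Nat.card_eq_fintype_card]; omega
  have hP := (isMinimallyKLEdgeConnected_iff_isPartitionMinimal G (by omega) hkV).1 hG
  have hunique : ∀ v, IsCutVtx G v → v = u := by
    intro v hv
    by_contra hvu
    have huv : u ≠ v := fun e => hvu e.symm
    obtain ⟨A, hAne, huA, hvA, hA⟩ := hv.exists_set huv
    obtain ⟨G', hG'⟩ := IsReattachment.exists_of_cutVertex huA hvA hA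
    have hlt := hG'.specRad_lt hP.connected hAne huv hxpos hxeig (hu v)
    have hle := hmax V G' hcard ((isMinimallyKLEdgeConnected_iff_isPartitionMinimal G'
      (by omega) hkV).2 (hG'.isPartitionMinimal hP))
    exact absurd hlt hle.not_gt
  obtain ⟨v, hv⟩ := hP.exists_isCutVtx_of_maximal hk hn hcard hmax hxpos hxeig hu
  exact ⟨hunique v hv ▸ hv, hunique⟩
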